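/- For every even nonnegative integer ℓ, every x ∈ [0,1], and every real p, ∫_{−1}^{1} P_ℓ(y)·cosh(p·arcsin(xy))/√(1−x²y²) dy = (2^{ℓ+1} ℓ! x^ℓ/(2ℓ+1)!) · ∏_{k=1}^{ℓ/2}(p²+(2k−1)²) · ₂F₁((ℓ+1+ip)/2, (ℓ+1−ip)/2; ℓ+3/2; x²). -/

import Mathlib

open Real Finset Complex

/-- Legendre polynomial of degree `l`, via Rodrigues' formula. -/
noncomputable def legendreP (l : ℕ) (y : ℝ) : ℝ :=
  (1 / (2 ^ l * (Nat.factorial l : ℝ))) *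
    iteratedDeriv l (fun t : ℝ => (t ^ 2 - 1) ^ l) y

/-- The Gauss hypergeometric function `₂F₁(a,b;c;z)` as a series. -/
noncomputable def hyp2F1 (a b c z : ℂ) : ℂ :=
  ∑' k : ℕ,
    Polynomial.eval a (ascPochhammer ℂ k) * Polynomial.eval b (ascPochhammer ℂ k) /
      (Polynomial.eval c (ascPochhammer ℂ k) * (Nat.factorial k : ℂ)) * z ^ k

/-- integration by parts, many times -/
lemma ibp (l : ℕ) (j : ℕ) : ∀ (Q : Polynomial ℝ), j ≤ l →
    ∫ y in (-1 : ℝ)..1, (Polynomial.derivative^[j] ((Polynomial.X ^ 2 - 1 : Polynomial ℝ) ^ l)).eval y * Q.eval y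
    = (-1) ^ j * ∫ y in (-1 : ℝ)..1, ((Polynomial.X ^ 2 - 1 : Polynomial ℝ) ^ l).eval y *
        (Polynomial.derivative^[j] Q).eval y := by
  induction j with
  | zero => intro Q _; simp
  | succ j ih =>
    intro Q hj
    have hdvd : (Polynomial.X ^ 2 - 1 : Polynomial ℝ) ∣
        Polynomial.derivative^[j] ((Polynomial.X ^ 2 - 1 : Polynomial ℝ) ^ l) :=
      (dvd_pow_self _ (by omega)).trans (Polynomial.pow_sub_dvd_iterate_derivative_pow _ l j)
    have hz : ∀ y : ℝ, y ^ 2 = 1 →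
        (Polynomial.derivative^[j] ((Polynomial.X ^ 2 - 1 : Polynomial ℝ) ^ l)).eval y = 0 := by
      intro y hy
      obtain ⟨R, hR⟩ := hdvd
      rw [hR]; simp [hy]
    rw [Function.iterate_succ_apply' Polynomial.derivative j (_ ^ l)]
    set V := Polynomial.derivative^[j] ((Polynomial.X ^ 2 - 1 : Polynomial ℝ) ^ l) with hV
    have := intervalIntegral.integral_deriv_mul_eq_sub (a := -1) (b := 1)
      (u := fun y => V.eval y) (v := fun y => Q.eval y)
      (u' := fun y => V.derivative.eval y) (v' := fun y => Q.derivative.eval y)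
      (fun y _ => V.hasDerivAt y) (fun y _ => Q.hasDerivAt y)
      (V.derivative.continuous.intervalIntegrable _ _) (Q.derivative.continuous.intervalIntegrable _ _)
    rw [intervalIntegral.integral_add
      (Continuous.intervalIntegrable (by fun_prop) _ _)
      (Continuous.intervalIntegrable (by fun_prop) _ _)] at this
    rw [hz 1 (by norm_num), hz (-1) (by norm_num)] at this
    have h2 := ih Q.derivative (by omega)
    rw [← Function.iterate_succ_apply] at h2
    rw [h2] at this
    rw [pow_succ]; linarith

lemma betaInt (l : ℕ) : ∀ k : ℕ, ∫ y in (-1 : ℝ)..1, (1 - y ^ 2) ^ l * y ^ (2 * k) =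
    2 ^ (2 * l + 1) * (l.factorial : ℝ) * (2 * k).factorial * (l + k).factorial /
      ((k.factorial : ℝ) * (2 * l + 2 * k + 1).factorial) := by
  induction l with
  | zero =>
    intro k
    simp only [pow_zero, one_mul, integral_pow]
    rw [show 2 * 0 + 2 * k + 1 = 2 * k + 1 by ring, Nat.factorial_succ (2 * k)]
    have h1 := Nat.cast_ne_zero (R := ℝ).2 (Nat.factorial_ne_zero k)
    have h2 := Nat.cast_ne_zero (R := ℝ).2 (Nat.factorial_ne_zero (2 * k))
    have h3 : (2 * (k:ℝ) + 1) ≠ 0 := by positivity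
    have : (-1 : ℝ) ^ (2 * k + 1) = -1 := by rw [pow_succ, pow_mul]; norm_num
    rw [this]
    simp
    field_simp
    norm_num
  | succ l ih =>
    intro k
    have : ∀ y : ℝ, (1 - y ^ 2) ^ (l + 1) * y ^ (2 * k) =
        (1 - y ^ 2) ^ l * y ^ (2 * k) - (1 - y ^ 2) ^ l * y ^ (2 * (k + 1)) := by intro y; ring
    simp_rw [this]
    rw [intervalIntegral.integral_sub
      (Continuous.intervalIntegrable (by fun_prop) _ _) (Continuous.intervalIntegrable (by fun_prop) _ _),
      ih, ih]
    rw [show l + (k + 1) = (l + k) + 1 by ring, show 2 * (k + 1) = 2 * k + 1 + 1 by ring,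
      show 2 * l + (2 * k + 1 + 1) + 1 = (2 * l + 2 * k + 1) + 1 + 1 by ring,
      show l + 1 + k = (l + k) + 1 by ring,
      show 2 * (l + 1) + 2 * k + 1 = (2 * l + 2 * k + 1) + 1 + 1 by ring]
    simp only [Nat.factorial_succ (2 * l + 2 * k + 1 + 1), Nat.factorial_succ (2 * l + 2 * k + 1),
      Nat.factorial_succ (l + k), Nat.factorial_succ l, Nat.factorial_succ k,
      Nat.factorial_succ (2 * k + 1), Nat.factorial_succ (2 * k)]
    have h1 := Nat.cast_ne_zero (R := ℝ).2 (Nat.factorial_ne_zero k)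
    have h2 := Nat.cast_ne_zero (R := ℝ).2 (Nat.factorial_ne_zero (2 * l + 2 * k + 1))
    push_cast
    have h3 : (2 * (l : ℝ) + 2 * k + 1 + 1) ≠ 0 := by positivity
    have h4 : (2 * (l : ℝ) + 2 * k + 1 + 1 + 1) ≠ 0 := by positivity
    have h5 : ((k : ℝ) + 1) ≠ 0 := by positivity
    field_simp
    ring

lemma legendreP_eq (l : ℕ) (y : ℝ) : legendreP l y = (1 / (2 ^ l * (Nat.factorial l : ℝ))) *
    (Polynomial.derivative^[l] ((Polynomial.X ^ 2 - 1 : Polynomial ℝ) ^ l)).eval y := by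
  unfold legendreP
  congr 1
  have : (fun t : ℝ => (t ^ 2 - 1) ^ l) =
      fun t => ((Polynomial.X ^ 2 - 1 : Polynomial ℝ) ^ l).eval t := by ext; simp
  rw [this, iteratedDeriv_eq_iterate]
  generalize ((Polynomial.X ^ 2 - 1 : Polynomial ℝ) ^ l) = W
  suffices h : ∀ j, deriv^[j] (fun t => W.eval t) = fun t => (Polynomial.derivative^[j] W).eval t by
    rw [h]
  intro j
  induction j with
  | zero => simp
  | succ j ih =>
    rw [Function.iterate_succ_apply', ih, Function.iterate_succ_apply']
    ext t; simp

lemma legendre_moment_aux (l m : ℕ) (hl : Even l) : ∫ y in (-1 : ℝ)..1, legendreP l y * y ^ m =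
    (1 / (2 ^ l * (Nat.factorial l : ℝ))) * (m.descFactorial l *
      ∫ y in (-1 : ℝ)..1, (1 - y ^ 2) ^ l * y ^ (m - l)) := by
  simp_rw [legendreP_eq, mul_assoc]
  rw [intervalIntegral.integral_const_mul]
  congr 1
  have := ibp l l (Polynomial.X ^ m) le_rfl
  simp only [Polynomial.eval_pow, Polynomial.eval_X] at this
  rw [this, hl.neg_one_pow, one_mul, ← intervalIntegral.integral_const_mul]
  congr 1; ext y
  rw [Polynomial.iterate_derivative_X_pow_eq_smul]
  have : (1 - y ^ 2) ^ l = (y ^ 2 - 1) ^ l := by rw [← hl.neg_pow]; ring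
  rw [this]
  simp; ring

lemma moment_zero (l m : ℕ) (hl : Even l) (h : m < l) :
    ∫ y in (-1 : ℝ)..1, legendreP l y * y ^ m = 0 := by
  rw [legendre_moment_aux l m hl, Nat.descFactorial_of_lt h]; simp

lemma moment_eq (l k : ℕ) (hl : Even l) :
    ∫ y in (-1 : ℝ)..1, legendreP l y * y ^ (l + 2 * k) =
    2 ^ (l + 1) * (l + 2 * k).factorial * (l + k).factorial /
      ((k.factorial : ℝ) * (2 * l + 2 * k + 1).factorial) := by
  rw [legendre_moment_aux l _ hl, Nat.add_sub_cancel_left, betaInt]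
  have h := Nat.factorial_mul_descFactorial (n := l + 2 * k) (k := l) (by omega)
  rw [Nat.add_sub_cancel_left] at h
  rw [← h]
  have h1 := Nat.cast_ne_zero (R := ℝ).2 (Nat.factorial_ne_zero k)
  have h2 := Nat.cast_ne_zero (R := ℝ).2 (Nat.factorial_ne_zero (2 * l + 2 * k + 1))
  have h3 := Nat.cast_ne_zero (R := ℝ).2 (Nat.factorial_ne_zero l)
  push_cast
  field_simp
  ring

lemma legendreP_cont (l : ℕ) : Continuous (legendreP l) := by
  have : legendreP l = fun y => (1 / (2 ^ l * (Nat.factorial l : ℝ))) *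
    (Polynomial.derivative^[l] ((Polynomial.X ^ 2 - 1 : Polynomial ℝ) ^ l)).eval y := by
    ext y; exact legendreP_eq l y
  rw [this]; fun_prop

/-- coefficients -/
noncomputable def aco (p : ℝ) (n : ℕ) : ℝ :=
  (∏ k ∈ Finset.range n, (p ^ 2 + (2 * (k : ℝ) + 1) ^ 2)) / (2 * n).factorial

lemma aco_pos (p : ℝ) (n : ℕ) : 0 < aco p n := by
  unfold aco; positivity

lemma aco_succ (p : ℝ) (n : ℕ) : aco p (n + 1) * ((2 * n + 2) * (2 * n + 1)) =
    aco p n * (p ^ 2 + (2 * (n : ℝ) + 1) ^ 2) := by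
  unfold aco
  rw [Finset.prod_range_succ, show 2 * (n + 1) = 2 * n + 1 + 1 by ring, Nat.factorial_succ,
    Nat.factorial_succ]
  have h2 := Nat.cast_ne_zero (R := ℝ).2 (Nat.factorial_ne_zero (2 * n))
  push_cast
  field_simp
  ring

lemma poch_prod (l k : ℕ) (p : ℝ) :
    Polynomial.eval (((l : ℂ) + 1 + (p : ℂ) * Complex.I) / 2) (ascPochhammer ℂ k) *
    Polynomial.eval (((l : ℂ) + 1 - (p : ℂ) * Complex.I) / 2) (ascPochhammer ℂ k) * 4 ^ k =
    ∏ j ∈ Finset.range k, ((p : ℂ) ^ 2 + ((l : ℂ) + 2 * j + 1) ^ 2) := by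
  induction k with
  | zero => simp
  | succ k ih =>
    rw [Finset.prod_range_succ, ← ih, ascPochhammer_succ_eval, ascPochhammer_succ_eval]
    ring_nf
    simp only [Complex.I_sq]
    ring

lemma poch_c (l k : ℕ) :
    Polynomial.eval ((l : ℂ) + 3 / 2) (ascPochhammer ℂ k) * 4 ^ k * (l + k).factorial *
      (2 * l + 1).factorial = (2 * l + 2 * k + 1).factorial * l.factorial := by
  induction k with
  | zero => simp; ring
  | succ k ih =>
    rw [ascPochhammer_succ_eval, ← add_assoc, Nat.factorial_succ (l + k),
      show 2 * l + 2 * (k + 1) + 1 = 2 * l + 2 * k + 1 + 1 + 1 by ring,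
      Nat.factorial_succ (2 * l + 2 * k + 1 + 1), Nat.factorial_succ (2 * l + 2 * k + 1)]
    push_cast
    linear_combination (2 * (l : ℂ) + 2 * k + 1 + 1 + 1) * (2 * l + 2 * k + 1 + 1) * ih

lemma term_eq (m k : ℕ) (x p : ℝ) :
    (((aco p (k + m) * x ^ (2 * (k + m))) * (2 ^ ((m + m) + 1) * ((m + m) + 2 * k).factorial * ((m + m) + k).factorial /
      (k.factorial * (2 * (m + m) + 2 * k + 1).factorial)) : ℝ) : ℂ) =
    ((2 ^ ((m + m) + 1) * (Nat.factorial (m + m) : ℝ) * x ^ (m + m) / (Nat.factorial (2 * (m + m) + 1) : ℝ) *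
          ∏ k ∈ Finset.range m, (p ^ 2 + (2 * (k : ℝ) + 1) ^ 2) : ℝ) : ℂ) *
    (Polynomial.eval ((((m + m : ℕ) : ℂ) + 1 + (p : ℂ) * Complex.I) / 2) (ascPochhammer ℂ k) *
     Polynomial.eval ((((m + m : ℕ) : ℂ) + 1 - (p : ℂ) * Complex.I) / 2) (ascPochhammer ℂ k) /
      (Polynomial.eval (((m + m : ℕ) : ℂ) + 3 / 2) (ascPochhammer ℂ k) * (Nat.factorial k : ℂ)) * ((x : ℂ) ^ 2) ^ k) := by
  have hp := poch_prod (m + m) k p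
  have hc := poch_c (m + m) k
  have e1 : aco p (k + m) = (∏ k ∈ Finset.range m, (p ^ 2 + (2 * (k : ℝ) + 1) ^ 2)) *
      (∏ j ∈ Finset.range k, (p ^ 2 + (((m + m : ℕ) : ℝ) + 2 * j + 1) ^ 2)) / ((m + m) + 2 * k).factorial := by
    unfold aco
    rw [add_comm k m, Finset.prod_range_add, show 2 * (m + k) = (m + m) + 2 * k by ring]
    congr 2
    apply Finset.prod_congr rfl
    intro j _
    push_cast; ring
  rw [e1]
  have e2 : ((∏ j ∈ Finset.range k, (p ^ 2 + (((m + m : ℕ) : ℝ) + 2 * j + 1) ^ 2) : ℝ) : ℂ) =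
     ∏ j ∈ Finset.range k, ((p : ℂ) ^ 2 + (((m + m : ℕ) : ℂ) + 2 * j + 1) ^ 2) := by push_cast; rfl
  set Q := ∏ j ∈ Finset.range k, (p ^ 2 + (((m + m : ℕ) : ℝ) + 2 * j + 1) ^ 2)
  set R := ∏ k ∈ Finset.range m, (p ^ 2 + (2 * (k : ℝ) + 1) ^ 2)
  rw [← e2] at hp
  set A := Polynomial.eval ((((m + m : ℕ) : ℂ) + 1 + (p : ℂ) * Complex.I) / 2) (ascPochhammer ℂ k)
  set B := Polynomial.eval ((((m + m : ℕ) : ℂ) + 1 - (p : ℂ) * Complex.I) / 2) (ascPochhammer ℂ k)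
  set C := Polynomial.eval (((m + m : ℕ) : ℂ) + 3 / 2) (ascPochhammer ℂ k)
  rw [show 2 * (k + m) = (m + m) + 2 * k by ring, pow_add x, pow_mul]
  have h1 := Nat.cast_ne_zero (R := ℂ).2 (Nat.factorial_ne_zero k)
  have h2 := Nat.cast_ne_zero (R := ℂ).2 (Nat.factorial_ne_zero (2 * (m + m) + 2 * k + 1))
  have h3 := Nat.cast_ne_zero (R := ℂ).2 (Nat.factorial_ne_zero (m + m))
  have h4 := Nat.cast_ne_zero (R := ℂ).2 (Nat.factorial_ne_zero (2 * (m + m) + 1))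
  have h5 := Nat.cast_ne_zero (R := ℂ).2 (Nat.factorial_ne_zero ((m + m) + 2 * k))
  have hC : C ≠ 0 := by
    intro h0
    rw [h0] at hc
    simp only [zero_mul] at hc
    exact (mul_ne_zero h2 h3) hc.symm
  simp only [Complex.ofReal_mul, Complex.ofReal_div, Complex.ofReal_pow, Complex.ofReal_natCast, ← hp,
    Complex.ofReal_ofNat]
  field_simp
  linear_combination ((R : ℂ) * (A * B) * (x : ℂ) ^ (k * 2) * (x : ℂ) ^ (m * 2)) * hc

lemma aco_summable (p r : ℝ) (h0 : 0 < r) (h1 : r < 1) :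
    Summable (fun n : ℕ => aco p n * (2 * n + 1) * (r ^ 2) ^ n) := by
  apply summable_of_ratio_test_tendsto_lt_one (l := r ^ 2) (by nlinarith)
  · refine Filter.Eventually.of_forall fun n => ?_
    have := aco_pos p n
    positivity
  · have hu : Filter.Tendsto (fun n : ℕ => 1 / (2 * (n : ℝ) + 1)) Filter.atTop (nhds 0) := by
      apply Filter.Tendsto.div_atTop tendsto_const_nhds
      apply Filter.tendsto_atTop_add_const_right
      exact Filter.Tendsto.const_mul_atTop (by norm_num) tendsto_natCast_atTop_atTop
    have hc : ContinuousAt (fun u : ℝ => (p ^ 2 * u ^ 2 + 1) * (1 + 2 * u) / (1 + u) * r ^ 2) 0 := by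
      apply ContinuousAt.mul _ continuousAt_const
      apply ContinuousAt.div (by fun_prop) (by fun_prop) (by norm_num)
    have := hc.tendsto.comp hu
    simp only [ne_eq, OfNat.ofNat_ne_zero, not_false_eq_true, zero_pow, mul_zero, zero_add, add_zero,
      mul_one, div_one, one_mul] at this
    refine this.congr fun n => ?_
    have ha := aco_pos p n
    have ha' := aco_pos p (n + 1)
    have hs := aco_succ p n
    have e : aco p (n + 1) = aco p n * (p ^ 2 + (2 * (n : ℝ) + 1) ^ 2) / ((2 * n + 2) * (2 * n + 1)) := by
      rw [eq_div_iff (by positivity)]; exact hs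
    rw [Real.norm_of_nonneg (by positivity), Real.norm_of_nonneg (by positivity), e]
    have h3 : (2 * (n : ℝ) + 1) ≠ 0 := by positivity
    have h4 : (2 * (n : ℝ) + 2) ≠ 0 := by positivity
    have h5 : 1 + 1 / (2 * (n : ℝ) + 1) ≠ 0 := by positivity
    have h6 : 1 + 1 / (2 * (n : ℝ) + 1) = (2 * n + 2) / (2 * n + 1) := by field_simp; ring
    simp only [Function.comp]
    rw [h6]
    push_cast
    field_simp
    ring

lemma aco_bounds (p r : ℝ) (h0 : 0 < r) (z : ℝ) (hz : |z| < r) (n : ℕ) :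
    ‖aco p n * z ^ (2 * n)‖ ≤ aco p n * (2 * n + 1) * (r ^ 2) ^ n := by
  have ha := aco_pos p n
  rw [norm_mul, norm_pow, Real.norm_of_nonneg ha.le, Real.norm_eq_abs, pow_mul]
  have : (|z| ^ 2) ^ n ≤ (r ^ 2) ^ n := by gcongr
  calc aco p n * (|z| ^ 2) ^ n ≤ aco p n * (r ^ 2) ^ n := by gcongr
    _ ≤ aco p n * (2 * n + 1) * (r ^ 2) ^ n := by
      have : 0 ≤ aco p n * (2 * n) * (r ^ 2) ^ n := by positivity
      nlinarith

lemma aco_bounds' (p r : ℝ) (h0 : 0 < r) (z : ℝ) (hz : |z| < r) (n : ℕ) :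
    ‖aco p n * ((2 * n : ℕ) * z ^ (2 * n - 1))‖ ≤ aco p n * (2 * n + 1) * (r ^ 2) ^ n * r⁻¹ := by
  have ha := aco_pos p n
  rw [norm_mul, norm_mul, norm_pow, Real.norm_of_nonneg ha.le, Real.norm_eq_abs, Real.norm_eq_abs]
  rcases Nat.eq_zero_or_pos n with rfl | hn
  · simp; positivity
  have e : (r ^ 2) ^ n * r⁻¹ = r ^ (2 * n - 1) := by
    rw [← pow_mul]
    obtain ⟨m, hm⟩ : ∃ m, 2 * n = m + 1 := ⟨2 * n - 1, by omega⟩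
    rw [hm]; simp [pow_succ]; field_simp
  rw [mul_assoc (aco p n * _), e, mul_assoc]
  have : |z| ^ (2 * n - 1) ≤ r ^ (2 * n - 1) := by gcongr
  push_cast
  rw [abs_of_nonneg (by positivity)]
  gcongr
  linarith

noncomputable def hh (p z : ℝ) : ℝ := ∑' n, aco p n * z ^ (2 * n)
noncomputable def hd (p z : ℝ) : ℝ := ∑' n : ℕ, aco p n * ((2 * n : ℕ) * z ^ (2 * n - 1))
noncomputable def hT (p z : ℝ) : ℝ := ∑' n : ℕ, aco p n * (z ^ (2 * n + 1) / (2 * n + 1))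

lemma exr (z : ℝ) (hz : |z| < 1) : ∃ r, 0 < r ∧ r < 1 ∧ |z| < r := by
  obtain ⟨r, h1, h2⟩ := exists_between hz
  exact ⟨r, (abs_nonneg z).trans_lt h1, h2, h1⟩

lemma hh_summable (p z : ℝ) (hz : |z| < 1) : Summable fun n => aco p n * z ^ (2 * n) := by
  obtain ⟨r, h0, h1, h2⟩ := exr z hz
  exact Summable.of_norm_bounded (aco_summable p r h0 h1) (aco_bounds p r h0 z h2)

lemma hd_summable (p z : ℝ) (hz : |z| < 1) :
    Summable fun n : ℕ => aco p n * ((2 * n : ℕ) * z ^ (2 * n - 1)) := by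
  obtain ⟨r, h0, h1, h2⟩ := exr z hz
  exact Summable.of_norm_bounded ((aco_summable p r h0 h1).mul_right _) (aco_bounds' p r h0 z h2)

lemma hh_deriv (p z : ℝ) (hz : |z| < 1) : HasDerivAt (hh p) (hd p z) z := by
  obtain ⟨r, h0, h1, h2⟩ := exr z hz
  refine hasDerivAt_tsum_of_isPreconnected (t := Set.Ioo (-r) r) (y₀ := z)
    (g := fun (n : ℕ) (z : ℝ) => aco p n * z ^ (2 * n))
    (g' := fun (n : ℕ) (z : ℝ) => aco p n * ((2 * n : ℕ) * z ^ (2 * n - 1)))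
    ((aco_summable p r h0 h1).mul_right r⁻¹)
    isOpen_Ioo isPreconnected_Ioo ?_ ?_ (abs_lt.1 h2) (hh_summable p z hz) (abs_lt.1 h2)
  · intro n y _
    exact (hasDerivAt_pow (2 * n) y).const_mul _
  · intro n y hy
    exact aco_bounds' p r h0 y (abs_lt.2 hy) n

lemma hT_deriv (p z : ℝ) (hz : |z| < 1) : HasDerivAt (hT p) (hh p z) z := by
  obtain ⟨r, h0, h1, h2⟩ := exr z hz
  refine hasDerivAt_tsum_of_isPreconnected (t := Set.Ioo (-r) r) (y₀ := (0 : ℝ))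
    (g := fun (n : ℕ) (z : ℝ) => aco p n * (z ^ (2 * n + 1) / (2 * n + 1)))
    (g' := fun (n : ℕ) (z : ℝ) => aco p n * z ^ (2 * n))
    (aco_summable p r h0 h1)
    isOpen_Ioo isPreconnected_Ioo ?_ ?_ (by simpa using h0) (by simp) (abs_lt.1 h2)
  · intro n y _
    have h3 : (2 * (n : ℝ) + 1) ≠ 0 := by positivity
    have := ((hasDerivAt_pow (2 * n + 1) y).div_const (2 * (n : ℝ) + 1)).const_mul (aco p n)
    refine HasDerivAt.congr_deriv this ?_
    rw [Nat.add_sub_cancel]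
    push_cast
    field_simp
  · intro n y hy
    exact aco_bounds p r h0 y (abs_lt.2 hy) n

lemma h_ode (p z : ℝ) (hz : |z| < 1) : (1 - z ^ 2) * hd p z - z * hh p z = p ^ 2 * hT p z := by
  have s1 := (hd_summable p z hz).hasSum
  have s0 := (hh_summable p z hz).hasSum
  have s2 := (hasSum_nat_add_iff' 1).2 s1
  have s3 := (s2.sub (s1.mul_left (z ^ 2))).sub (s0.mul_left z)
  have e : ∀ n : ℕ, aco p (n + 1) * ((2 * (n + 1) : ℕ) * z ^ (2 * (n + 1) - 1)) -
      z ^ 2 * (aco p n * ((2 * n : ℕ) * z ^ (2 * n - 1))) - z * (aco p n * z ^ (2 * n)) =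
      p ^ 2 * (aco p n * (z ^ (2 * n + 1) / (2 * n + 1))) := by
    intro n
    have hs := aco_succ p n
    have h3 : (2 * (n : ℝ) + 1) ≠ 0 := by positivity
    have e1 : z ^ 2 * (aco p n * ((2 * n : ℕ) * z ^ (2 * n - 1))) =
        aco p n * (2 * n) * z ^ (2 * n + 1) := by
      rcases Nat.eq_zero_or_pos n with rfl | hn
      · simp
      · obtain ⟨m, hm⟩ : ∃ m, 2 * n = m + 1 := ⟨2 * n - 1, by omega⟩
        have : (2 * (n : ℝ)) = m + 1 := by exact_mod_cast hm
        rw [this, hm]; push_cast; ring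
    rw [e1, show 2 * (n + 1) - 1 = 2 * n + 1 by omega]
    push_cast
    field_simp
    linear_combination (z ^ (2 * n + 1)) * hs
  simp_rw [e] at s3
  have := s3.tsum_eq
  rw [tsum_mul_left] at this
  change p ^ 2 * hT p z = _ at this
  rw [this]
  simp only [hd, hh]
  simp
  ring

lemma abs_sin_lt (θ : ℝ) (h : θ ∈ Set.Ioo (-(Real.pi / 2)) (Real.pi / 2)) : |Real.sin θ| < 1 := by
  have := Real.cos_pos_of_mem_Ioo h
  rw [← sq_lt_one_iff_abs_lt_one]
  nlinarith [Real.sin_sq_add_cos_sq θ]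

lemma exp_sol (p q : ℝ) (hq : q ^ 2 = p ^ 2) (θ : ℝ)
    (h : θ ∈ Set.Ioo (-(Real.pi / 2)) (Real.pi / 2)) :
    hh p (Real.sin θ) * Real.cos θ - q * hT p (Real.sin θ) = Real.exp (-(q * θ)) := by
  let g : ℝ → ℝ := fun θ =>
    (hh p (Real.sin θ) * Real.cos θ - q * hT p (Real.sin θ)) * Real.exp (q * θ)
  have hd' : ∀ t ∈ Set.Ioo (-(Real.pi / 2)) (Real.pi / 2), HasDerivAt g 0 t := by
    intro t ht
    have hs := abs_sin_lt t ht
    have d1 := (hh_deriv p _ hs).comp t (Real.hasDerivAt_sin t)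
    have d2 := (hT_deriv p _ hs).comp t (Real.hasDerivAt_sin t)
    have d3 : HasDerivAt (fun t : ℝ => Real.exp (q * t)) (Real.exp (q * t) * (q * 1)) t :=
      ((hasDerivAt_id t).const_mul q).exp
    have := ((d1.mul (Real.hasDerivAt_cos t)).sub (d2.const_mul q)).mul d3
    refine HasDerivAt.congr_deriv this ?_
    have ho := h_ode p _ hs
    have hc := Real.sin_sq_add_cos_sq t
    simp only [Pi.mul_apply, Pi.sub_apply, Function.comp]
    have : hd p (Real.sin t) * Real.cos t ^ 2 = Real.sin t * hh p (Real.sin t) + q ^ 2 * hT p (Real.sin t) := by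
      rw [hq, ← ho]; linear_combination (hd p (Real.sin t)) * hc
    linear_combination Real.exp (q * t) * this
  have hconv : Convex ℝ (Set.Ioo (-(Real.pi / 2)) (Real.pi / 2)) := convex_Ioo _ _
  have h0 : (0 : ℝ) ∈ Set.Ioo (-(Real.pi / 2)) (Real.pi / 2) := by
    constructor <;> linarith [Real.pi_pos]
  have hg := isOpen_Ioo.is_const_of_deriv_eq_zero (𝕜 := ℝ) (f := g) isPreconnected_Ioo
    (fun t ht => (hd' t ht).differentiableAt.differentiableWithinAt)
    (fun t ht => (hd' t ht).deriv) h h0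
  have h00 : hh p 0 = 1 := by
    unfold hh
    rw [tsum_eq_single 0]
    · simp [aco]
    · intro n hn; simp [hn]
  have hT0 : hT p 0 = 0 := by simp [hT]
  simp only [g, Real.sin_zero, Real.cos_zero, h00, hT0, mul_zero, Real.exp_zero] at hg
  rw [Real.exp_neg, ← one_div, eq_div_iff (Real.exp_pos _).ne', hg]
  ring

lemma hh_eq (p z : ℝ) (hz : |z| < 1) :
    hh p z = Real.cosh (p * Real.arcsin z) / Real.sqrt (1 - z ^ 2) := by
  obtain ⟨h1, h2⟩ := abs_lt.1 hz
  have hm : Real.arcsin z ∈ Set.Ioo (-(Real.pi / 2)) (Real.pi / 2) :=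
    ⟨Real.neg_pi_div_two_lt_arcsin.2 h1, Real.arcsin_lt_pi_div_two.2 h2⟩
  have e1 := exp_sol p p rfl _ hm
  have e2 := exp_sol p (-p) (by ring) _ hm
  rw [Real.sin_arcsin h1.le h2.le, Real.cos_arcsin] at e1 e2
  have : 0 < Real.sqrt (1 - z ^ 2) := Real.sqrt_pos.2 (by nlinarith)
  rw [eq_div_iff this.ne', Real.cosh_eq]
  rw [show -(-p * Real.arcsin z) = p * Real.arcsin z by ring] at e2
  linarith

lemma main_integrable (x : ℝ) (hx : x ∈ Set.Icc (0 : ℝ) 1) (p : ℝ) :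
    IntervalIntegrable (fun y => Real.cosh (p * Real.arcsin (x * y)) / Real.sqrt (1 - x ^ 2 * y ^ 2))
      MeasureTheory.volume (-1) 1 := by
  have h1 : IntervalIntegrable (fun y : ℝ => 1 / Real.sqrt (1 - y ^ 2)) MeasureTheory.volume (-1) 1 := by
    apply intervalIntegral.intervalIntegrable_deriv_of_nonneg (g := Real.arcsin)
      Real.continuous_arcsin.continuousOn
    · intro y hy
      norm_num at hy
      exact Real.hasDerivAt_arcsin hy.1.ne' hy.2.ne
    · intro y _; positivity
  refine (h1.const_mul (Real.cosh (p * (Real.pi / 2)))).mono_fun' ?_ ?_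
  · apply Measurable.aestronglyMeasurable
    have := Real.continuous_arcsin.measurable
    fun_prop
  · rw [Set.uIoc_of_le (by norm_num), ← MeasureTheory.restrict_Ioo_eq_restrict_Ioc]
    filter_upwards [MeasureTheory.ae_restrict_mem measurableSet_Ioo] with y hy
    have hy2 : y ^ 2 < 1 := by nlinarith [hy.1, hy.2]
    have hxy : x ^ 2 * y ^ 2 ≤ y ^ 2 := by
      have : x ^ 2 ≤ 1 := by nlinarith [hx.1, hx.2]
      nlinarith [sq_nonneg y]
    have hc := Real.cosh_pos (p * Real.arcsin (x * y))
    rw [Real.norm_of_nonneg (by positivity), div_eq_mul_one_div]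
    have hpos : 0 < Real.sqrt (1 - y ^ 2) := Real.sqrt_pos.2 (by linarith)
    gcongr ?_ * (1 / Real.sqrt ?_)
    · rw [Real.cosh_le_cosh, abs_mul, abs_mul, abs_of_pos (by positivity : 0 < Real.pi / 2)]
      gcongr
      exact abs_le.2 ⟨Real.neg_pi_div_two_le_arcsin _, Real.arcsin_le_pi_div_two _⟩
    · linarith

lemma main_hasSum (l : ℕ) (x : ℝ) (hx : x ∈ Set.Icc (0 : ℝ) 1) (p : ℝ) :
    HasSum (fun n => aco p n * x ^ (2 * n) * ∫ y in (-1 : ℝ)..1, legendreP l y * y ^ (2 * n))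
      (∫ y in (-1 : ℝ)..1,
        legendreP l y * Real.cosh (p * Real.arcsin (x * y)) / Real.sqrt (1 - x ^ 2 * y ^ 2)) := by
  obtain ⟨C, hC⟩ := isCompact_Icc.exists_bound_of_continuousOn
    (s := Set.Icc (-1 : ℝ) 1) (legendreP_cont l).continuousOn
  have key : ∀ y ∈ Set.Ioo (-1 : ℝ) 1, HasSum (fun n => aco p n * (x * y) ^ (2 * n))
      (Real.cosh (p * Real.arcsin (x * y)) / Real.sqrt (1 - x ^ 2 * y ^ 2)) := by
    intro y hy
    have : |x * y| < 1 := by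
      rw [abs_mul, abs_of_nonneg hx.1]
      have := abs_lt.2 hy
      nlinarith [hx.1, hx.2, abs_nonneg y]
    rw [← mul_pow, ← hh_eq p _ this]
    exact (hh_summable p _ this).hasSum
  have hint := main_integrable x hx p
  simp_rw [← intervalIntegral.integral_const_mul]
  simp only [intervalIntegral.integral_of_le (show (-1 : ℝ) ≤ 1 by norm_num),
    MeasureTheory.integral_Ioc_eq_integral_Ioo]
  rw [intervalIntegrable_iff_integrableOn_Ioo_of_le (by norm_num)] at hint
  have hae : ∀ᵐ y ∂(MeasureTheory.volume.restrict (Set.Ioo (-1 : ℝ) 1)), y ∈ Set.Ioo (-1 : ℝ) 1 :=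
    MeasureTheory.ae_restrict_mem measurableSet_Ioo
  apply MeasureTheory.hasSum_integral_of_dominated_convergence
    (fun n y => C * (aco p n * (x * y) ^ (2 * n)))
  · intro n
    have := legendreP_cont l
    exact Continuous.aestronglyMeasurable (by fun_prop)
  · intro n
    filter_upwards [hae] with y hy
    have hb := hC y (Set.Ioo_subset_Icc_self hy)
    have ha := aco_pos p n
    have hnn : 0 ≤ aco p n * (x * y) ^ (2 * n) := by rw [pow_mul]; positivity
    have : aco p n * x ^ (2 * n) * (legendreP l y * y ^ (2 * n)) =
      legendreP l y * (aco p n * (x * y) ^ (2 * n)) := by rw [mul_pow]; ring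
    rw [this, norm_mul, Real.norm_of_nonneg hnn]
    gcongr
  · filter_upwards [hae] with y hy
    exact (key y hy).summable.mul_left C
  · refine (hint.const_mul C).congr ?_
    filter_upwards [hae] with y hy
    rw [tsum_mul_left, (key y hy).tsum_eq]
  · filter_upwards [hae] with y hy
    have := (key y hy).mul_left (legendreP l y)
    rw [← mul_div_assoc] at this
    refine this.congr_fun ?_
    intro n
    rw [mul_pow]; ring

/-- For `ℓ` even, `x ∈ [0,1]` and `p ∈ ℝ`,
`∫_{-1}^1 P_ℓ(y) cosh(p arcsin(xy))/√(1-x²y²) dy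
 = (2^{ℓ+1} ℓ! x^ℓ/(2ℓ+1)!) ∏_{k=1}^{ℓ/2}(p²+(2k-1)²) ·
   ₂F₁((ℓ+1+ip)/2, (ℓ+1-ip)/2; ℓ+3/2; x²)`. -/
theorem legendre_cosh_arcsin_hypergeometric (l : ℕ) (hl : Even l) (x : ℝ)
    (hx : x ∈ Set.Icc (0 : ℝ) 1) (p : ℝ) :
    ((∫ y in (-1 : ℝ)..1,
        legendreP l y * Real.cosh (p * Real.arcsin (x * y)) / Real.sqrt (1 - x ^ 2 * y ^ 2) : ℝ) : ℂ) =
      ((2 ^ (l + 1) * (Nat.factorial l : ℝ) * x ^ l / (Nat.factorial (2 * l + 1) : ℝ) *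
          ∏ k ∈ Finset.range (l / 2), (p ^ 2 + (2 * (k : ℝ) + 1) ^ 2) : ℝ) : ℂ) *
        hyp2F1 (((l : ℂ) + 1 + (p : ℂ) * Complex.I) / 2)
          (((l : ℂ) + 1 - (p : ℂ) * Complex.I) / 2) ((l : ℂ) + 3 / 2) ((x : ℂ) ^ 2) := by
  obtain ⟨m, rfl⟩ := hl
  have hl : Even (m + m) := ⟨m, rfl⟩
  have hs := main_hasSum (m + m) x hx p
  have hs2 := (hasSum_nat_add_iff' m).2 hs
  rw [Finset.sum_eq_zero, sub_zero] at hs2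
  swap
  · intro i hi
    rw [moment_zero (m + m) (2 * i) hl (by have := Finset.mem_range.1 hi; omega), mul_zero]
  rw [← hs2.tsum_eq, Complex.ofReal_tsum, hyp2F1, ← tsum_mul_left]
  congr 1
  ext k
  rw [show (m + m) / 2 = m by omega, ← term_eq m k x p]
  congr 2
  rw [← moment_eq (m + m) k hl, show m + m + 2 * k = 2 * (k + m) by ring]
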